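/- Let G be a finite group and V an irreducible finite-dimensional complex representation of G that is self-dual, with Frobenius–Schur indicator ν := |G|⁻¹ ∑_{g∈G} χ_V(g²) ∈ {+1, −1}. Then every nonzero G-invariant bilinear form β on V is non-degenerate and satisfies β(w, v) = ν · β(v, w) for all v, w ∈ V; that is, β is symmetric if ν = +1 and antisymmetric if ν = −1. -/

import Mathlib

noncomputable section

/-- The Frobenius–Schur indicator of a representation of a finite group `G`:
`ν(V) = |G|⁻¹ ∑_{g ∈ G} χ_V(g²)`. -/
def fsIndicator (G : Type*) [Group G] [Fintype G] {W : Type*} [AddCommGroup W] [Module ℂ W]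
    (ρ : Representation ℂ G W) : ℂ :=
  (Fintype.card G : ℂ)⁻¹ * ∑ g : G, LinearMap.trace ℂ W (ρ (g * g))

/-- A representation is irreducible if the space is nonzero and the only subspaces stable
under all `ρ g` are `⊥` and `⊤`. -/
def RepIsIrreducible {G W : Type*} [Group G] [AddCommGroup W] [Module ℂ W]
    (ρ : Representation ℂ G W) : Prop :=
  Nontrivial W ∧ ∀ p : Submodule ℂ W, (∀ g : G, ∀ x ∈ p, ρ g x ∈ p) → p = ⊥ ∨ p = ⊤

/-- A representation is self-dual if it is isomorphic, as a `G`-representation, to its dual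
equipped with the contragredient action. -/
def RepIsSelfDual {G W : Type*} [Group G] [AddCommGroup W] [Module ℂ W]
    (ρ : Representation ℂ G W) : Prop :=
  ∃ e : W ≃ₗ[ℂ] Module.Dual ℂ W, ∀ (g : G) (v : W), e (ρ g v) = ρ.dual g (e v)

section InvariantForm

variable {G W : Type*} [Group G] [AddCommGroup W] [Module ℂ W]

/-- A nonzero invariant bilinear form on an irreducible representation has trivial kernel. -/
theorem RepIsIrreducible.ker_eq_bot {ρ : Representation ℂ G W} (hirr : RepIsIrreducible ρ)
    {β : W →ₗ[ℂ] W →ₗ[ℂ] ℂ} (hβ : β ≠ 0)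
    (hGinv : ∀ (g : G) (v w : W), β (ρ g v) (ρ g w) = β v w) :
    LinearMap.ker β = ⊥ := by
  refine (hirr.2 (LinearMap.ker β) fun g x hx => ?_).resolve_right
    fun h => hβ (LinearMap.ker_eq_top.1 h)
  rw [LinearMap.mem_ker] at hx ⊢
  ext w
  have h := hGinv g x (ρ g⁻¹ w)
  rw [ρ.self_inv_apply, hx] at h
  simpa using h

/-- Schur's lemma for forms: every invariant bilinear form on an irreducible representation is
a multiple of a given nonzero one. -/
theorem RepIsIrreducible.exists_eq_smul [FiniteDimensional ℂ W] {ρ : Representation ℂ G W}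
    (hirr : RepIsIrreducible ρ) {β : W →ₗ[ℂ] W →ₗ[ℂ] ℂ} (hβ : β ≠ 0)
    (hGinv : ∀ (g : G) (v w : W), β (ρ g v) (ρ g w) = β v w)
    (γ : W →ₗ[ℂ] W →ₗ[ℂ] ℂ) (hγ : ∀ (g : G) (v w : W), γ (ρ g v) (ρ g w) = γ v w) :
    ∃ c : ℂ, γ = c • β := by
  have := hirr.1
  let e : W ≃ₗ[ℂ] Module.Dual ℂ W := LinearEquiv.ofInjectiveOfFinrankEq β
    (LinearMap.ker_eq_bot.1 (hirr.ker_eq_bot hβ hGinv)) Subspace.dual_finrank_eq.symm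
  have he (x : W) : e x = β x := rfl
  obtain ⟨c, hc⟩ := Module.End.exists_eigenvalue (e.symm.toLinearMap ∘ₗ γ : Module.End ℂ W)
  obtain ⟨v, hv⟩ := hc.exists_hasEigenvector
  have hv' : γ v = c • β v := by
    have h : e.symm (γ v) = c • v := hv.apply_eq_smul
    rw [e.symm_apply_eq.1 h, map_smul, he]
  refine ⟨c, sub_eq_zero.1 (by_contra fun hne => hv.2 ?_)⟩
  have hker := hirr.ker_eq_bot hne fun g v w => by simp [hGinv, hγ]
  rw [← Submodule.mem_bot ℂ, ← hker, LinearMap.mem_ker]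
  simp [hv']

/-- The sum of all translates of a bilinear form over a finite group. -/
def bilinSum [Fintype G] (ρ : Representation ℂ G W) (γ : W →ₗ[ℂ] W →ₗ[ℂ] ℂ) :
    W →ₗ[ℂ] W →ₗ[ℂ] ℂ :=
  ∑ g : G, γ.compl₁₂ (ρ g) (ρ g)

theorem bilinSum_apply [Fintype G] (ρ : Representation ℂ G W) (γ : W →ₗ[ℂ] W →ₗ[ℂ] ℂ)
    (v w : W) : bilinSum ρ γ v w = ∑ g : G, γ (ρ g v) (ρ g w) := by
  simp [bilinSum, LinearMap.sum_apply]

theorem bilinSum_invariant [Fintype G] (ρ : Representation ℂ G W) (γ : W →ₗ[ℂ] W →ₗ[ℂ] ℂ)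
    (h : G) (v w : W) : bilinSum ρ γ (ρ h v) (ρ h w) = bilinSum ρ γ v w := by
  simp only [bilinSum_apply, ← Module.End.mul_apply, ← map_mul]
  exact Fintype.sum_equiv (Equiv.mulRight h) _ _ fun _ => rfl

theorem trace_mul_self_eq_sum {ι : Type*} [Fintype ι] (b : Module.Basis ι ℂ W)
    (T : Module.End ℂ W) :
    LinearMap.trace ℂ W (T * T) = ∑ i, ∑ j, b.coord i (T (b j)) * b.coord j (T (b i)) := by
  classical
  rw [LinearMap.trace_eq_matrix_trace ℂ b, LinearMap.toMatrix_mul]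
  simp [Matrix.trace, Matrix.mul_apply, LinearMap.toMatrix_apply]

/-- If `β` is invariant, every translate-sum of a form is a multiple of `β`, and
`β(w, v) = c β(v, w)`, then `c` is the Frobenius–Schur indicator. -/
theorem fsIndicator_eq_of_flip_eq_smul [Fintype G] [FiniteDimensional ℂ W]
    {ρ : Representation ℂ G W} {β : W →ₗ[ℂ] W →ₗ[ℂ] ℂ} (hβ : β ≠ 0)
    (hGinv : ∀ (g : G) (v w : W), β (ρ g v) (ρ g w) = β v w)
    (hsum : ∀ γ, ∃ a : ℂ, bilinSum ρ γ = a • β) {c : ℂ} (hc : ∀ v w, β w v = c * β v w) :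
    fsIndicator G ρ = c := by
  let b := Module.finBasis ℂ W
  choose f hf using fun i j => hsum ((b.coord i).smulRight (b.coord j))
  have hf' (i j) (v w : W) :
      ∑ g : G, b.coord i (ρ g v) * b.coord j (ρ g w) = f i j * β v w := by
    have h := LinearMap.congr_fun₂ (hf i j) v w
    simpa [bilinSum_apply] using h
  have hexp (v w : W) : β v w = ∑ i, ∑ j, b.coord i v * b.coord j w * β (b i) (b j) := by
    rw [← LinearMap.sum_repr_mul_repr_mul b b v w]
    simp [Finsupp.sum_fintype, mul_assoc]
  have hcard : ∑ i, ∑ j, f i j * β (b i) (b j) = Fintype.card G := by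
    obtain ⟨v, w, hvw⟩ : ∃ v w, β v w ≠ 0 := by
      by_contra! h
      exact hβ (LinearMap.ext₂ h)
    refine mul_right_cancel₀ hvw ?_
    calc (∑ i, ∑ j, f i j * β (b i) (b j)) * β v w
        = ∑ i, ∑ j, (∑ g : G, b.coord i (ρ g v) * b.coord j (ρ g w)) * β (b i) (b j) := by
          simp only [hf', Finset.sum_mul]
          exact Finset.sum_congr rfl fun i _ => Finset.sum_congr rfl fun j _ => by ring
      _ = ∑ g : G, β (ρ g v) (ρ g w) := by
          simp only [Finset.sum_mul, hexp (ρ _ v) (ρ _ w)]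
          rw [Finset.sum_comm (s := Finset.univ (α := G))]
          exact Finset.sum_congr rfl fun i _ => Finset.sum_comm
      _ = Fintype.card G * β v w := by simp [hGinv]
  have htrace : ∑ g : G, LinearMap.trace ℂ W (ρ (g * g)) = c * Fintype.card G := by
    calc ∑ g : G, LinearMap.trace ℂ W (ρ (g * g))
        = ∑ i, ∑ j, ∑ g : G, b.coord i (ρ g (b j)) * b.coord j (ρ g (b i)) := by
          simp only [map_mul ρ, trace_mul_self_eq_sum b]
          rw [Finset.sum_comm]
          exact Finset.sum_congr rfl fun i _ => Finset.sum_comm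
      _ = c * Fintype.card G := by
          simp only [hf', ← hcard, Finset.mul_sum]
          exact Finset.sum_congr rfl fun i _ => Finset.sum_congr rfl fun j _ => by
            rw [hc (b i) (b j)]; ring
  rw [fsIndicator, htrace]
  field_simp

end InvariantForm

/-- For an irreducible self-dual finite-dimensional complex representation `V` of a finite
group `G` with Frobenius–Schur indicator `ν`, every nonzero `G`-invariant bilinear form `β`
on `V` is non-degenerate and satisfies `β(w, v) = ν · β(v, w)` for all `v, w`. -/
theorem invariant_form_nondegenerate_and_fsIndicator_symmetric
    {G W : Type*} [Group G] [Fintype G] [AddCommGroup W] [Module ℂ W]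
    [FiniteDimensional ℂ W] (ρ : Representation ℂ G W)
    (hirr : RepIsIrreducible ρ) (hsd : RepIsSelfDual ρ)
    (β : W →ₗ[ℂ] W →ₗ[ℂ] ℂ) (hβ : β ≠ 0)
    (hGinv : ∀ (g : G) (v w : W), β (ρ g v) (ρ g w) = β v w) :
    (∀ v : W, (∀ w : W, β v w = 0) → v = 0) ∧
    (∀ w : W, (∀ v : W, β v w = 0) → w = 0) ∧
    (∀ v w : W, β w v = fsIndicator G ρ * β v w) := by
  have hflip : β.flip ≠ 0 := fun h => hβ (by rw [← β.flip_flip, h]; rfl)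
  have hflip_inv (g : G) (v w : W) : β.flip (ρ g v) (ρ g w) = β.flip v w := hGinv g w v
  refine ⟨fun v hv => ?_, fun w hw => ?_, ?_⟩
  · exact LinearMap.ker_eq_bot'.1 (hirr.ker_eq_bot hβ hGinv) v (LinearMap.ext hv)
  · exact LinearMap.ker_eq_bot'.1 (hirr.ker_eq_bot hflip hflip_inv) w (LinearMap.ext hw)
  · obtain ⟨c, hc⟩ := hirr.exists_eq_smul hβ hGinv β.flip hflip_inv
    have hc' (v w : W) : β w v = c * β v w := LinearMap.congr_fun₂ hc v w
    rw [fsIndicator_eq_of_flip_eq_smul hβ hGinv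
      (fun γ => hirr.exists_eq_smul hβ hGinv _ (bilinSum_invariant ρ γ)) hc']
    exact hc'

end
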